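/- For every θ ∈ (0,π), (1 − θ cot θ)/sin²θ = Σ_{k=1}^∞ [ kπ/(kπ+θ)³ + kπ/(kπ−θ)³ ], the series converging absolutely. -/

import Mathlib

open Real Set

/-- The partial fraction expansion of `x cot x - 1` on `(0, π)`. -/
lemma hasSum_mul_cot_sub_one {x : ℝ} (hx : x ∈ Ioo 0 π) :
    HasSum (fun k : ℕ => x * (1 / (x - ((k : ℝ) + 1) * π) + 1 / (x + ((k : ℝ) + 1) * π)))
      (x * Real.cot x - 1) := by
  obtain ⟨h0, h1⟩ := hx
  have hmem : ((x / π : ℝ) : ℂ) ∈ Complex.integerComplement := by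
    rintro ⟨n, hn⟩
    have hn' : (n : ℝ) = x / π := by exact_mod_cast hn
    have hpos : (0 : ℝ) < n := hn' ▸ div_pos h0 pi_pos
    have hlt : (n : ℝ) < 1 := hn' ▸ (div_lt_one pi_pos).mpr h1
    norm_cast at hpos hlt
    omega
  have hsum := (summable_cotTerm hmem).hasSum
  rw [← cot_series_rep' hmem] at hsum
  have hreal : HasSum (fun k : ℕ => 1 / (x / π - ((k : ℝ) + 1)) + 1 / (x / π + ((k : ℝ) + 1)))
      (π * Real.cot (π * (x / π)) - 1 / (x / π)) := by
    rw [← Complex.hasSum_ofReal]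
    convert hsum using 1
    · ext k
      simp [cotTerm]
    · push_cast
      rfl
  have hscale := hreal.mul_left (x / π)
  convert! hscale using 1
  · ext k
    have e₁ : x / π - ((k : ℝ) + 1) = (x - ((k : ℝ) + 1) * π) / π := by field_simp
    have e₂ : x / π + ((k : ℝ) + 1) = (x + ((k : ℝ) + 1) * π) / π := by field_simp
    rw [e₁, e₂, one_div_div, one_div_div]
    field_simp
  · rw [mul_div_cancel₀ x pi_ne_zero]
    field_simp

lemma hasDerivAt_mul_one_div_sub_add_one_div_add {x a : ℝ} (hsub : x - a ≠ 0) (hadd : x + a ≠ 0) :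
    HasDerivAt (fun y => y * (1 / (y - a) + 1 / (y + a)))
      (a / (x + a) ^ 2 - a / (x - a) ^ 2) x := by
  have h := (hasDerivAt_id x).mul
    ((((hasDerivAt_id x).sub_const a).inv hsub).add (((hasDerivAt_id x).add_const a).inv hadd))
  convert! h using 1
  · ext y
    simp
  · simp only [id, Pi.add_apply, Pi.inv_apply]
    field_simp
    ring

lemma hasDerivAt_div_add_sq_sub_div_sub_sq {x a : ℝ} (hsub : x - a ≠ 0) (hadd : x + a ≠ 0) :
    HasDerivAt (fun y => a / (y + a) ^ 2 - a / (y - a) ^ 2)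
      (-2 * (a / (a + x) ^ 3 + a / (a - x) ^ 3)) x := by
  have h := ((((hasDerivAt_id x).add_const a).pow 2).inv (pow_ne_zero 2 hadd)).const_mul a |>.sub
    (((((hasDerivAt_id x).sub_const a).pow 2).inv (pow_ne_zero 2 hsub)).const_mul a)
  have hsub' : a - x ≠ 0 := by rwa [← neg_sub, neg_ne_zero]
  have e₁ : a + x = x + a := add_comm a x
  have e₂ : (a - x) ^ 3 = -(x - a) ^ 3 := by ring
  convert! h using 1
  simp only [id, Pi.pow_apply]
  rw [e₁, e₂]
  field_simp
  ring

lemma abs_div_add_sq_sub_div_sub_sq_le {x r : ℝ} (hx : x ∈ Ioo 0 r) (hr : r < π) (k : ℕ) :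
    |((k : ℝ) + 1) * π / (x + ((k : ℝ) + 1) * π) ^ 2 -
        ((k : ℝ) + 1) * π / (x - ((k : ℝ) + 1) * π) ^ 2| ≤
      4 * π / (π - r) ^ 2 * (1 / ((k : ℝ) + 1) ^ 2) := by
  obtain ⟨h0, h1⟩ := hx
  have hn : (1 : ℝ) ≤ (k : ℝ) + 1 := by simp
  set n : ℝ := (k : ℝ) + 1
  have hδ : 0 < π - r := sub_pos.mpr hr
  have hlow : n * (π - r) ≤ n * π - x := by nlinarith
  have hpos : 0 < n * (π - r) := by positivity
  have hsub : 0 < n * π - x := hpos.trans_le hlow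
  have hadd : 0 < x + n * π := by positivity
  have e : n * π / (x + n * π) ^ 2 - n * π / (x - n * π) ^ 2 =
      -(4 * x * ((n * π) / (x + n * π)) ^ 2 / (n * π - x) ^ 2) := by
    have e₁ : (x - n * π) ^ 2 = (n * π - x) ^ 2 := by ring
    rw [e₁]
    field_simp
    ring
  rw [e, abs_neg, abs_of_nonneg (by positivity)]
  calc 4 * x * ((n * π) / (x + n * π)) ^ 2 / (n * π - x) ^ 2
      ≤ 4 * π * 1 ^ 2 / (n * (π - r)) ^ 2 := by
        gcongr
        · linarith
        · rw [div_le_one hadd]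
          linarith
    _ = 4 * π / (π - r) ^ 2 * (1 / n ^ 2) := by
        field_simp

lemma abs_div_add_cube_add_div_sub_cube_le {x r : ℝ} (hx : x ∈ Ioo 0 r) (hr : r < π) (k : ℕ) :
    |((k : ℝ) + 1) * π / (((k : ℝ) + 1) * π + x) ^ 3 +
        ((k : ℝ) + 1) * π / (((k : ℝ) + 1) * π - x) ^ 3| ≤
      2 * π / (π - r) ^ 3 * (1 / ((k : ℝ) + 1) ^ 2) := by
  obtain ⟨h0, h1⟩ := hx
  have hn : (1 : ℝ) ≤ (k : ℝ) + 1 := by simp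
  set n : ℝ := (k : ℝ) + 1
  have hδ : 0 < π - r := sub_pos.mpr hr
  have hlow : n * (π - r) ≤ n * π - x := by nlinarith
  have hpos : 0 < n * (π - r) := by positivity
  have hsub : 0 < n * π - x := hpos.trans_le hlow
  rw [abs_of_nonneg (by positivity)]
  calc n * π / (n * π + x) ^ 3 + n * π / (n * π - x) ^ 3
      ≤ n * π / (n * (π - r)) ^ 3 + n * π / (n * (π - r)) ^ 3 := by
        gcongr
        linarith
    _ = 2 * π / (π - r) ^ 3 * (1 / n ^ 2) := by
        field_simp
        ring

lemma summable_const_mul_one_div_nat_add_one_sq (c : ℝ) :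
    Summable fun k : ℕ => c * (1 / ((k : ℝ) + 1) ^ 2) := by
  have h := (summable_nat_add_iff 1).mpr (Real.summable_one_div_nat_pow.mpr one_lt_two)
  simpa using h.mul_left c

lemma hasDerivAt_cot {x : ℝ} (hx : Real.sin x ≠ 0) :
    HasDerivAt Real.cot (-1 / Real.sin x ^ 2) x := by
  have h := (Real.hasDerivAt_cos x).div (Real.hasDerivAt_sin x) hx
  convert! h using 1
  · ext y
    exact Real.cot_eq_cos_div_sin y
  · rw [← Real.sin_sq_add_cos_sq x]
    ring

lemma hasDerivAt_mul_cot_sub_one {x : ℝ} (hx : Real.sin x ≠ 0) :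
    HasDerivAt (fun y => y * Real.cot y - 1) (Real.cot x - x / Real.sin x ^ 2) x := by
  convert! ((hasDerivAt_id x).mul (hasDerivAt_cot hx)).sub_const 1 using 1
  simp only [id]
  ring

lemma hasDerivAt_cot_sub_div_sin_sq {x : ℝ} (hx : Real.sin x ≠ 0) :
    HasDerivAt (fun y => Real.cot y - y / Real.sin y ^ 2)
      (-2 * ((1 - x * Real.cot x) / Real.sin x ^ 2)) x := by
  convert! (hasDerivAt_cot hx).sub
    ((hasDerivAt_id x).div ((Real.hasDerivAt_sin x).pow 2) (pow_ne_zero 2 hx)) using 1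
  simp only [id, Pi.pow_apply]
  rw [Real.cot_eq_cos_div_sin]
  field_simp
  ring

/-- Partial fraction series for `m(θ) = (1 - θ cot θ)/sin²θ`: for `θ ∈ (0,π)`,
`m(θ) = Σ_{k=1}^∞ [kπ/(kπ+θ)³ + kπ/(kπ-θ)³]`, converging absolutely. -/
theorem m_partial_fraction_series (θ : ℝ) (hθ : θ ∈ Ioo 0 π) :
    HasSum (fun k : ℕ =>
      ((k : ℝ) + 1) * π / (((k : ℝ) + 1) * π + θ) ^ 3 +
        ((k : ℝ) + 1) * π / (((k : ℝ) + 1) * π - θ) ^ 3)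
      ((1 - θ * Real.cot θ) / Real.sin θ ^ 2) ∧
    Summable (fun k : ℕ =>
      |((k : ℝ) + 1) * π / (((k : ℝ) + 1) * π + θ) ^ 3 +
        ((k : ℝ) + 1) * π / (((k : ℝ) + 1) * π - θ) ^ 3|) := by
  obtain ⟨h0, h1⟩ := hθ
  obtain ⟨r, hθr, hr⟩ := exists_between h1
  have hθs : θ ∈ Ioo 0 r := ⟨h0, hθr⟩
  have hsin : ∀ x ∈ Ioo 0 r, Real.sin x ≠ 0 := fun x hx =>
    (Real.sin_pos_of_pos_of_lt_pi hx.1 (hx.2.trans hr)).ne'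
  have hadd : ∀ (k : ℕ), ∀ x ∈ Ioo 0 r, x + ((k : ℝ) + 1) * π ≠ 0 := fun k x hx => by
    have := hx.1
    positivity
  have hsub : ∀ (k : ℕ), ∀ x ∈ Ioo 0 r, x - ((k : ℝ) + 1) * π ≠ 0 := fun k x hx => by
    have : 0 ≤ (k : ℝ) * π := by positivity
    linarith [hx.2]
  have hbound₁ := summable_const_mul_one_div_nat_add_one_sq (4 * π / (π - r) ^ 2)
  have hbound₂ := summable_const_mul_one_div_nat_add_one_sq (2 * π / (π - r) ^ 3)
  have hfirst : ∀ x ∈ Ioo 0 r,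
      ∑' k : ℕ, (((k : ℝ) + 1) * π / (x + ((k : ℝ) + 1) * π) ^ 2 -
        ((k : ℝ) + 1) * π / (x - ((k : ℝ) + 1) * π) ^ 2) =
      Real.cot x - x / Real.sin x ^ 2 := fun x hx => by
    have hd := hasDerivAt_tsum_of_isPreconnected hbound₁ isOpen_Ioo isPreconnected_Ioo
      (fun k y hy => hasDerivAt_mul_one_div_sub_add_one_div_add (hsub k y hy) (hadd k y hy))
      (fun k y hy => abs_div_add_sq_sub_div_sub_sq_le hy hr k) hθs
      (hasSum_mul_cot_sub_one ⟨h0, h1⟩).summable hx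
    refine hd.unique ((hasDerivAt_mul_cot_sub_one (hsin x hx)).congr_of_eventuallyEq ?_)
    filter_upwards [isOpen_Ioo.mem_nhds hx] with y hy
    exact (hasSum_mul_cot_sub_one ⟨hy.1, hy.2.trans hr⟩).tsum_eq
  have hsummable : Summable fun k : ℕ =>
      ((k : ℝ) + 1) * π / (((k : ℝ) + 1) * π + θ) ^ 3 +
        ((k : ℝ) + 1) * π / (((k : ℝ) + 1) * π - θ) ^ 3 := Summable.of_norm_bounded hbound₂
    (fun k => abs_div_add_cube_add_div_sub_cube_le hθs hr k)
  refine ⟨?_, hsummable.abs⟩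
  have hd := hasDerivAt_tsum_of_isPreconnected (hbound₂.mul_left 2) isOpen_Ioo isPreconnected_Ioo
    (fun k y hy => hasDerivAt_div_add_sq_sub_div_sub_sq (hsub k y hy) (hadd k y hy))
    (fun k y hy => by
      rw [norm_mul, norm_neg, Real.norm_ofNat]
      exact mul_le_mul_of_nonneg_left (abs_div_add_cube_add_div_sub_cube_le hy hr k) zero_le_two)
    hθs (Summable.of_norm_bounded hbound₁
      fun k => abs_div_add_sq_sub_div_sub_sq_le hθs hr k) hθs
  have heq := hd.unique ((hasDerivAt_cot_sub_div_sin_sq (hsin θ hθs)).congr_of_eventuallyEq (by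
    filter_upwards [isOpen_Ioo.mem_nhds hθs] with y hy
    exact hfirst y hy))
  rw [tsum_mul_left] at heq
  rw [← mul_left_cancel₀ (by norm_num : (-2 : ℝ) ≠ 0) heq]
  exact hsummable.hasSum
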